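/- Let d be an admissible sequence and a an admissible family. Then for every real s > 0 the series G(s) = Σ_{m≥0} Σ_{n∈ℤ} c^{2n+m} q^{n-m/2} d_m a(n,m) · Σ_{l : l≥l₁, -(n+m) ≤ l ≤ -n-1} (cα)^l q^{l/2} (q^{sm} - q^{s(|n+m|-n)}) converges absolutely (inner sums over empty ranges being 0), and lim_{s→0⁺} s·G(s) = 0. -/

import Mathlib

open Filter Topology

noncomputable section

/-- `qc q x` is the real power `q ^ x`, viewed as a complex number. -/
def qc (q : ℝ) (x : ℝ) : ℂ := ((q ^ x : ℝ) : ℂ)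

/-- An admissible sequence: `d m = q^(m/2) (c₁ c^m + c₂ c^(-m))` for all `m ≥ l₁`. -/
def IsAdmissibleSeq (q : ℝ) (c : ℂ) (l₁ : ℤ) (d : ℕ → ℂ) : Prop :=
  ∃ c₁ c₂ : ℂ, ∀ m : ℕ, l₁ ≤ (m : ℤ) →
    d m = qc q ((m : ℝ) / 2) * (c₁ * c ^ (m : ℤ) + c₂ * c ^ (-(m : ℤ)))

/-- An admissible family on `ℤ × ℕ`, given by region asymptotics. -/
def IsAdmissibleFam (q : ℝ) (l₁ : ℤ) (a : ℤ → ℕ → ℂ) : Prop :=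
  ∃ (k₁ k₂ k₃ : ℂ) (A B : ℤ → ℂ), ∀ (n : ℤ) (m : ℕ),
    (l₁ ≤ n → a n m = k₁) ∧
    (-l₁ < n → n < l₁ → l₁ ≤ n + (m : ℤ) → a n m = A n) ∧
    (n ≤ -l₁ → l₁ ≤ n + (m : ℤ) → a n m = qc q (-(n : ℝ)) * k₂) ∧
    (n ≤ -l₁ → -l₁ < n + (m : ℤ) → n + (m : ℤ) < l₁ →
      a n m = qc q (-(n : ℝ)) * B (n + m)) ∧
    (n + (m : ℤ) ≤ -l₁ → a n m = qc q (-(2 * (n : ℝ) + (m : ℝ))) * k₃)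

/-- An `l`-stabilized family on `ℤ × ℕ` (the regions do not depend on `l`). -/
def IsStabilizedFam (q : ℝ) (c : ℂ) (l₁ : ℤ) (e : ℤ → ℕ → ℂ) : Prop :=
  ∃ (u w : ℂ) (f v : ℤ → ℂ) (N : ℤ), 2 * l₁ < N ∧ ∀ (n : ℤ) (m : ℕ),
    (l₁ ≤ n → e n m = (c ^ 2 * (q : ℂ)) ^ n * (c * qc q (1 / 2)) ^ m * u) ∧
    (-l₁ < n → n < l₁ → N ≤ (m : ℤ) → e n m = (c * qc q (1 / 2)) ^ m * f n) ∧
    (n ≤ -l₁ → -l₁ < n + (m : ℤ) → n + (m : ℤ) < l₁ → N ≤ (m : ℤ) →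
      e n m = qc q ((m : ℝ) / 2) * c ^ (-(m : ℤ)) * v (n + m)) ∧
    (n + (m : ℤ) ≤ -l₁ → e n m = (c ^ 2 * (q : ℂ)⁻¹) ^ n * (c * qc q (-(1 / 2))) ^ m * w)

theorem norm_qc {q : ℝ} (hq : 0 < q) (x : ℝ) : ‖qc q x‖ = q ^ x := by
  rw [qc, Complex.norm_real, Real.norm_of_nonneg (Real.rpow_nonneg hq.le x)]

theorem IsAdmissibleSeq.exists_norm_le {q : ℝ} (hq : 0 < q) {c : ℂ} (hc : ‖c‖ = 1) {l₁ : ℤ}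
    {d : ℕ → ℂ} (hd : IsAdmissibleSeq q c l₁ d) :
    ∃ D : ℝ, 0 ≤ D ∧ ∀ m : ℕ, ‖d m‖ ≤ D * q ^ ((m : ℝ) / 2) := by
  obtain ⟨c₁, c₂, h⟩ := hd
  have hpos (i : ℕ) : 0 < q ^ ((i : ℝ) / 2) := Real.rpow_pos_of_pos hq _
  have hS : ∀ i ∈ Finset.range l₁.toNat, 0 ≤ ‖d i‖ / q ^ ((i : ℝ) / 2) :=
    fun i _ => div_nonneg (norm_nonneg _) (hpos i).le
  have hS0 := Finset.sum_nonneg hS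
  refine ⟨‖c₁‖ + ‖c₂‖ + ∑ i ∈ Finset.range l₁.toNat, ‖d i‖ / q ^ ((i : ℝ) / 2),
    by positivity, fun m => ?_⟩
  rw [← div_le_iff₀ (hpos m)]
  by_cases hm : l₁ ≤ (m : ℤ)
  · have hle : ‖c₁ * c ^ (m : ℤ) + c₂ * c ^ (-(m : ℤ))‖ ≤ ‖c₁‖ + ‖c₂‖ := by
      refine (norm_add_le _ _).trans_eq ?_
      simp only [norm_mul, norm_zpow, hc, one_zpow, mul_one]
    rw [h m hm, norm_mul, norm_qc hq, mul_div_cancel_left₀ _ (hpos m).ne']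
    linarith
  · have := Finset.single_le_sum hS (Finset.mem_range.2 (by omega : m < l₁.toNat))
    linarith [norm_nonneg c₁, norm_nonneg c₂]

theorem IsAdmissibleFam.exists_norm_le {q : ℝ} (hq : 0 < q) {l₁ : ℤ}
    {a : ℤ → ℕ → ℂ} (ha : IsAdmissibleFam q l₁ a) :
    ∃ A : ℝ, 0 ≤ A ∧ ∀ (n : ℤ) (m : ℕ), n ≤ -l₁ → n + (m : ℤ) < 0 →
      ‖a n m‖ ≤ A * q ^ (-(2 * (n : ℝ) + (m : ℝ))) := by
  obtain ⟨k₁, k₂, k₃, A, B, h⟩ := ha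
  have hS : ∀ i ∈ Finset.Ioo (-l₁) 0, 0 ≤ ‖B i‖ * q ^ (i : ℝ) :=
    fun i _ => mul_nonneg (norm_nonneg _) (Real.rpow_nonneg hq.le _)
  have hS0 := Finset.sum_nonneg hS
  refine ⟨‖k₃‖ + ∑ i ∈ Finset.Ioo (-l₁) 0, ‖B i‖ * q ^ (i : ℝ), by positivity,
    fun n m hn hm => ?_⟩
  obtain ⟨-, -, -, h4, h5⟩ := h n m
  by_cases hk : n + (m : ℤ) ≤ -l₁
  · rw [h5 hk, norm_mul, norm_qc hq, mul_comm]
    gcongr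
    linarith
  · push Not at hk
    have key : ‖a n m‖ =
        ‖B (n + m)‖ * q ^ ((n + m : ℤ) : ℝ) * q ^ (-(2 * (n : ℝ) + (m : ℝ))) := by
      rw [h4 hn hk (by omega), norm_mul, norm_qc hq, mul_assoc, ← Real.rpow_add hq, mul_comm]
      congr 2
      push_cast
      ring
    rw [key]
    gcongr
    have := Finset.single_le_sum hS (Finset.mem_Ioo.2 ⟨hk, hm⟩)
    linarith [norm_nonneg k₃]

theorem summable_natAbs_of_summable {f : ℕ → ℝ} (hf : Summable f) :
    Summable fun k : ℤ => f k.natAbs :=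
  Summable.of_nat_of_neg (by simpa using hf) (by simpa using hf)

theorem exists_sum_Icc_rpow_half_le {q : ℝ} (hq0 : 0 < q) (hq1 : q < 1) :
    ∃ K : ℝ, 0 ≤ K ∧ ∀ u v : ℤ, 0 < u → ∑ l ∈ Finset.Icc u v, q ^ ((l : ℝ) / 2) ≤ K := by
  have hr0 : 0 ≤ q ^ (1 / 2 : ℝ) := Real.rpow_nonneg hq0.le _
  have hsum := summable_natAbs_of_summable (summable_geometric_of_lt_one hr0
    (Real.rpow_lt_one hq0.le hq1 (by norm_num)))
  refine ⟨∑' k : ℤ, (q ^ (1 / 2 : ℝ)) ^ k.natAbs, tsum_nonneg fun k => pow_nonneg hr0 _,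
    fun u v hu => ?_⟩
  refine le_trans (Finset.sum_le_sum fun l hl => ?_)
    (hsum.sum_le_tsum (Finset.Icc u v) fun k _ => pow_nonneg hr0 _)
  have hl0 : 0 ≤ l := by have := (Finset.mem_Icc.1 hl).1; omega
  lift l to ℕ using hl0
  rw [Int.natAbs_natCast, ← Real.rpow_mul_natCast hq0.le]
  apply le_of_eq
  congr 1
  push_cast
  ring

theorem one_sub_rpow_le {q : ℝ} (hq : 0 < q) (x : ℝ) : 1 - q ^ x ≤ x * -Real.log q := by
  rw [Real.rpow_def_of_pos hq]
  linarith [Real.add_one_le_exp (Real.log q * x)]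

theorem inv_one_sub_rpow_le {q s : ℝ} (hq0 : 0 < q) (hq1 : q < 1) (hs : 0 < s) :
    (1 - q ^ s)⁻¹ ≤ (1 + s * -Real.log q) / (s * -Real.log q) := by
  have hx : 0 < s * -Real.log q := mul_pos hs (neg_pos.2 (Real.log_neg hq0 hq1))
  have hlt : q ^ s < 1 := Real.rpow_lt_one hq0.le hq1 hs
  have hqs : q ^ s = (Real.exp (s * -Real.log q))⁻¹ := by
    rw [Real.rpow_def_of_pos hq0, ← Real.exp_neg]
    congr 1
    ring
  have hle : q ^ s * (1 + s * -Real.log q) ≤ 1 := by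
    rw [hqs, inv_mul_le_iff₀ (Real.exp_pos _)]
    linarith [Real.add_one_le_exp (s * -Real.log q)]
  rw [inv_eq_one_div, div_le_div_iff₀ (by linarith) hx]
  linarith

theorem hasSum_shear_mul_geometric {f : ℤ → ℝ} (hf : Summable f) (hf0 : 0 ≤ f) {r : ℝ}
    (hr0 : 0 ≤ r) (hr1 : r < 1) :
    HasSum (fun p : ℤ × ℕ => f (p.1 + p.2) * r ^ p.2) ((∑' k, f k) * (1 - r)⁻¹) := by
  have hg := hasSum_geometric_of_lt_one hr0 hr1
  have hprod := hf.hasSum.mul hg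
    (hf.mul_of_nonneg hg.summable hf0 fun m => pow_nonneg hr0 m)
  let e : ℤ × ℕ ≃ ℤ × ℕ :=
    { toFun := fun p => (p.1 + p.2, p.2)
      invFun := fun p => (p.1 - p.2, p.2)
      left_inv := fun p => by simp
      right_inv := fun p => by simp }
  exact e.hasSum_iff.2 hprod

theorem norm_qc_sub_qc_le {q s : ℝ} (hq0 : 0 < q) (hq1 : q < 1) (hs : 0 < s) (n : ℤ) (m : ℕ)
    (hn : n + (m : ℤ) < 0) :
    ‖qc q (s * (m : ℝ)) - qc q (s * (((|n + (m : ℤ)| : ℤ) : ℝ) - (n : ℝ)))‖ ≤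
      q ^ (s * (m : ℝ)) * (2 * s * -Real.log q * ((n + (m : ℤ)).natAbs : ℝ)) := by
  have hj : ((n + (m : ℤ)).natAbs : ℝ) = -((n : ℝ) + m) := by
    rw [Nat.cast_natAbs, abs_of_neg hn]
    push_cast
    ring
  have hexp : s * (((|n + (m : ℤ)| : ℤ) : ℝ) - (n : ℝ)) =
      s * m + 2 * s * ((n + (m : ℤ)).natAbs : ℝ) := by
    rw [hj, abs_of_neg hn]
    push_cast
    ring
  have hle : q ^ (2 * s * ((n + (m : ℤ)).natAbs : ℝ)) ≤ 1 :=
    Real.rpow_le_one hq0.le hq1.le (by positivity)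
  rw [hexp, qc, qc, ← Complex.ofReal_sub, Complex.norm_real, Real.rpow_add hq0, ← mul_one_sub,
    Real.norm_of_nonneg (mul_nonneg (Real.rpow_nonneg hq0.le _) (by linarith))]
  gcongr
  exact (one_sub_rpow_le hq0 _).trans_eq (by ring)

/-- component of claim (1) with `l ≥ l₁` and `-(n+m) ≤ l ≤ -n-1`. -/
theorem stmt5 (q : ℝ) (hq0 : 0 < q) (hq1 : q < 1) (c α : ℂ)
    (hc : ‖c‖ = 1) (hα : ‖α‖ = 1) (l₁ : ℤ) (hl₁ : 0 < l₁)
    (d : ℕ → ℂ) (hd : IsAdmissibleSeq q c l₁ d)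
    (a : ℤ → ℕ → ℂ) (ha : IsAdmissibleFam q l₁ a)
    (T : ℝ → ℤ × ℕ → ℂ)
    (hT : ∀ (s : ℝ) (n : ℤ) (m : ℕ),
      T s (n, m) = c ^ (2 * n + (m : ℤ)) * qc q ((n : ℝ) - (m : ℝ) / 2) * d m * a n m *
        ∑ l ∈ Finset.Icc (max l₁ (-(n + (m : ℤ)))) (-n - 1),
          (c * α) ^ l * qc q ((l : ℝ) / 2) *
            (qc q (s * (m : ℝ)) -
             qc q (s * (((|n + (m : ℤ)| : ℤ) : ℝ) - (n : ℝ))))) :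
    (∀ s : ℝ, 0 < s → Summable fun p : ℤ × ℕ => ‖T s p‖) ∧
    Tendsto (fun s : ℝ => (s : ℂ) * ∑' p : ℤ × ℕ, T s p)
      (𝓝[>] (0 : ℝ)) (𝓝 0) := by
  have hL : 0 < -Real.log q := neg_pos.2 (Real.log_neg hq0 hq1)
  obtain ⟨D, hD0, hD⟩ := hd.exists_norm_le hq0 hc
  obtain ⟨A, hA0, hA⟩ := ha.exists_norm_le hq0
  obtain ⟨K, hK0, hK⟩ := exists_sum_Icc_rpow_half_le hq0 hq1
  set f : ℤ → ℝ := fun k => (k.natAbs : ℝ) * q ^ k.natAbs with hf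
  have hf0 : 0 ≤ f := fun k => by simp only [hf, Pi.zero_apply]; positivity
  have hfsum : Summable f := by
    have h := summable_pow_mul_geometric_of_norm_lt_one (R := ℝ) 1 (r := q)
      (by rwa [Real.norm_of_nonneg hq0.le])
    simp only [pow_one] at h
    exact summable_natAbs_of_summable h
  set C : ℝ := D * A * K * (2 * -Real.log q) with hC
  have hC0 : 0 ≤ C := by positivity
  have hbound : ∀ s : ℝ, 0 < s → ∀ p : ℤ × ℕ,
      ‖T s p‖ ≤ C * s * (f (p.1 + p.2) * (q ^ s) ^ p.2) := by
    rintro s hs ⟨n, m⟩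
    have hrhs : 0 ≤ C * s * (f (n + m) * (q ^ s) ^ m) := by
      have : 0 ≤ f (n + m) := hf0 _
      positivity
    rw [hT]
    by_cases hn : -l₁ ≤ n
    · rw [Finset.Icc_eq_empty (by have := le_max_left l₁ (-(n + (m : ℤ))); omega)]
      simpa using hrhs
    by_cases hm : 0 ≤ n + (m : ℤ)
    · have hexp : (((|n + (m : ℤ)| : ℤ) : ℝ) - (n : ℝ)) = m := by
        rw [abs_of_nonneg hm]
        push_cast
        ring
      rw [hexp, sub_self]
      simpa using hrhs
    push Not at hn hm
    have hsum : ‖∑ l ∈ Finset.Icc (max l₁ (-(n + (m : ℤ)))) (-n - 1),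
        (c * α) ^ l * qc q ((l : ℝ) / 2) *
          (qc q (s * (m : ℝ)) - qc q (s * (((|n + (m : ℤ)| : ℤ) : ℝ) - (n : ℝ))))‖ ≤
        K * (q ^ (s * (m : ℝ)) * (2 * s * -Real.log q * ((n + (m : ℤ)).natAbs : ℝ))) := by
      rw [← Finset.sum_mul, norm_mul]
      refine mul_le_mul ((norm_sum_le _ _).trans ?_) (norm_qc_sub_qc_le hq0 hq1 hs n m hm)
        (norm_nonneg _) hK0
      simp only [norm_mul, norm_zpow, hc, hα, mul_one, one_zpow, one_mul, norm_qc hq0]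
      exact hK _ _ (lt_max_of_lt_left hl₁)
    have hpow : q ^ ((n : ℝ) - (m : ℝ) / 2) * q ^ ((m : ℝ) / 2) *
        q ^ (-(2 * (n : ℝ) + (m : ℝ))) = q ^ (n + (m : ℤ)).natAbs := by
      rw [← Real.rpow_add hq0, ← Real.rpow_add hq0, ← Real.rpow_natCast, Nat.cast_natAbs,
        abs_of_neg hm]
      congr 1
      push_cast
      ring
    calc _ = q ^ ((n : ℝ) - (m : ℝ) / 2) * ‖d m‖ * ‖a n m‖ * _ := by
          rw [norm_mul, norm_mul, norm_mul, norm_mul, norm_zpow, hc, one_zpow, one_mul,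
            norm_qc hq0]
      _ ≤ q ^ ((n : ℝ) - (m : ℝ) / 2) * (D * q ^ ((m : ℝ) / 2)) *
          (A * q ^ (-(2 * (n : ℝ) + (m : ℝ)))) *
          (K * (q ^ (s * (m : ℝ)) * (2 * s * -Real.log q * ((n + (m : ℤ)).natAbs : ℝ)))) := by
          gcongr
          · exact hD m
          · exact hA n m hn.le hm
      _ = C * s * (((n + (m : ℤ)).natAbs * (q ^ ((n : ℝ) - (m : ℝ) / 2) * q ^ ((m : ℝ) / 2) *
          q ^ (-(2 * (n : ℝ) + (m : ℝ))))) * (q ^ s) ^ m) := by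
          rw [Real.rpow_mul_natCast hq0.le, hC]
          ring
      _ = _ := by rw [hpow]
  have hmaj : ∀ s : ℝ, 0 < s →
      HasSum (fun p : ℤ × ℕ => C * s * (f (p.1 + p.2) * (q ^ s) ^ p.2))
        (C * s * ((∑' k, f k) * (1 - q ^ s)⁻¹)) := fun s hs =>
    (hasSum_shear_mul_geometric hfsum hf0 (Real.rpow_nonneg hq0.le s)
      (Real.rpow_lt_one hq0.le hq1 hs)).mul_left _
  have hsummable : ∀ s : ℝ, 0 < s → Summable fun p : ℤ × ℕ => ‖T s p‖ := fun s hs =>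
    Summable.of_nonneg_of_le (fun p => norm_nonneg _) (hbound s hs) (hmaj s hs).summable
  refine ⟨hsummable, squeeze_zero_norm'
    (a := fun s => C * (∑' k, f k) / -Real.log q * (s * (1 + s * -Real.log q))) ?_ ?_⟩
  · filter_upwards [self_mem_nhdsWithin] with s hs
    have hs : 0 < s := hs
    have hS : 0 ≤ ∑' k, f k := tsum_nonneg hf0
    rw [norm_mul, Complex.norm_real, Real.norm_of_nonneg hs.le]
    calc s * ‖∑' p, T s p‖ ≤ s * (C * s * ((∑' k, f k) * (1 - q ^ s)⁻¹)) := by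
          gcongr
          exact tsum_of_norm_bounded (hmaj s hs) (hbound s hs)
      _ ≤ s * (C * s * ((∑' k, f k) *
          ((1 + s * -Real.log q) / (s * -Real.log q)))) := by
          gcongr
          exact inv_one_sub_rpow_le hq0 hq1 hs
      _ = _ := by
          field_simp
  · have hcont : Continuous fun s : ℝ =>
        C * (∑' k, f k) / -Real.log q * (s * (1 + s * -Real.log q)) := by fun_prop
    simpa using (hcont.tendsto 0).mono_left nhdsWithin_le_nhds
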